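/- arXiv:1903.09177 — 10 statements merged into one kernel-verified Lean document; each statement's English description precedes it below -/
import Mathlib

section
/- Let G be a finite abelian group of order v (written additively), let D ⊆ G be a difference set with |D| = k, 0 < k < v, and parameter Λ, and let H be a subgroup of G of order h such that D ∩ H = ∅. Then h·(S + 1) ≤ v, where S = √(k(v−1)/(v−k)). -/
open scoped Classical

/-- The number of ordered pairs of elements of a difference set `D` whose difference lies in a
given subgroup `H`. -/
theorem card_pairs_sub_mem {G : Type*} [AddCommGroup G] [Fintype G] (D : Finset G) (Λ : ℕ)
    (hD : ∀ g : G, g ≠ 0 → ((D ×ˢ D).filter (fun p => p.1 - p.2 = g)).card = Λ)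
    (H : AddSubgroup G) :
    (((D ×ˢ D).filter (fun p => p.1 - p.2 ∈ H)).card : ℝ)
      = D.card + ((Nat.card H : ℝ) - 1) * Λ := by
  set T : Finset G := Finset.univ.filter (· ∈ H) with hT
  have h0T : (0 : G) ∈ T := by simp [hT, H.zero_mem]
  have hTcard : T.card = Nat.card H := by
    rw [Nat.card_eq_fintype_card, Fintype.card_subtype]
  have hfib : ((D ×ˢ D).filter (fun p => p.1 - p.2 ∈ H)).card
      = ∑ g ∈ T, ((D ×ˢ D).filter (fun p => p.1 - p.2 = g)).card := by
    rw [Finset.card_eq_sum_card_fiberwise (f := fun p : G × G => p.1 - p.2) (t := T)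
      (fun p hp => by simpa [hT] using (Finset.mem_filter.1 hp).2)]
    refine Finset.sum_congr rfl fun g hg => ?_
    congr 1
    rw [Finset.filter_filter]
    refine Finset.filter_congr fun p _ => ⟨And.right, fun h => ⟨?_, h⟩⟩
    rw [h]
    exact (Finset.mem_filter.1 hg).2
  have hdiag : ((D ×ˢ D).filter (fun p => p.1 - p.2 = 0)).card = D.card := by
    rw [← Finset.diag_card D]
    congr 1
    ext ⟨a, b⟩
    simp only [Finset.mem_filter, Finset.mem_product, Finset.mem_diag, sub_eq_zero]
    grind
  rw [hfib, ← Finset.add_sum_erase T _ h0T, hdiag,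
    Finset.sum_congr rfl fun g hg => hD g (Finset.ne_of_mem_erase hg), Finset.sum_const,
    smul_eq_mul, Nat.cast_add, Nat.cast_mul, Finset.cast_card_erase_of_mem h0T, hTcard]

/-- A set missing the subgroup `H` meets at most `[G : H] - 1` cosets of `H`, so by Cauchy–Schwarz
it has many pairs of elements lying in a common coset. -/
theorem sq_card_le_index_sub_one_mul {G : Type*} [AddCommGroup G] [Fintype G] (D : Finset G)
    (H : AddSubgroup G) (hdisj : ∀ x ∈ D, x ∉ H) :
    (D.card : ℝ) ^ 2
      ≤ ((H.index : ℝ) - 1) * ((D ×ˢ D).filter (fun p => p.1 - p.2 ∈ H)).card := by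
  set a : G ⧸ H → Finset G := fun q => D.filter (fun d => (d : G ⧸ H) = q) with ha
  set U : Finset (G ⧸ H) := Finset.univ.erase 0 with hU
  have hmem : ∀ x ∈ D, (x : G ⧸ H) ∈ U := fun x hx => by
    simpa [hU, QuotientAddGroup.eq_zero_iff] using hdisj x hx
  have hUcard : (U.card : ℝ) = (H.index : ℝ) - 1 := by
    rw [hU, Finset.cast_card_erase_of_mem (Finset.mem_univ _), Finset.card_univ,
      AddSubgroup.index, Nat.card_eq_fintype_card]
  have hsum : D.card = ∑ q ∈ U, (a q).card :=
    Finset.card_eq_sum_card_fiberwise (f := fun d : G => (d : G ⧸ H)) hmem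
  have hsq : ((D ×ˢ D).filter (fun p => p.1 - p.2 ∈ H)).card = ∑ q ∈ U, (a q).card ^ 2 := by
    rw [Finset.card_eq_sum_card_fiberwise (f := fun p : G × G => (p.1 : G ⧸ H)) (t := U)
      (fun p hp => hmem _ (Finset.mem_product.1 (Finset.mem_filter.1 hp).1).1)]
    refine Finset.sum_congr rfl fun q _ => ?_
    rw [sq, ← Finset.card_product]
    congr 1
    ext ⟨x, y⟩
    simp only [ha, Finset.mem_filter, Finset.mem_product]
    rw [← QuotientAddGroup.eq_iff_sub_mem]
    grind
  rw [hsq, hsum, ← hUcard]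
  exact_mod_cast sq_sum_le_card_mul_sum_sq (s := U) (f := fun q => (a q).card)

/-- If `D` is a difference set with parameter `Λ` in a finite abelian group `G`
of order `v`, with `|D| = k`, `0 < k < v`, and `H` is a subgroup of order `h` disjoint from `D`,
then `h·(S + 1) ≤ v` where `S = √(k(v−1)/(v−k))`. -/
theorem stmt_0 {G : Type*} [AddCommGroup G] [Fintype G]
    (D : Finset G) (Λ : ℕ)
    (hk0 : 0 < D.card) (hkv : D.card < Fintype.card G)
    (hD : ∀ g : G, g ≠ 0 → ((D ×ˢ D).filter (fun p => p.1 - p.2 = g)).card = Λ)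
    (H : AddSubgroup G) (hdisj : ∀ x ∈ D, x ∉ H) :
    (Nat.card H : ℝ) *
        (Real.sqrt (((D.card : ℝ) * ((Fintype.card G : ℝ) - 1)) /
            ((Fintype.card G : ℝ) - (D.card : ℝ))) + 1)
      ≤ (Fintype.card G : ℝ) := by
  have hpairs := card_pairs_sub_mem D Λ hD H
  have hall := card_pairs_sub_mem D Λ hD ⊤
  have hcs := sq_card_le_index_sub_one_mul D H hdisj
  have hv : (Nat.card H : ℝ) * H.index = Fintype.card G := by
    rw [← Nat.card_eq_fintype_card]
    exact_mod_cast H.card_mul_index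
  have hm1 : (1 : ℝ) ≤ H.index := by
    exact_mod_cast Nat.one_le_iff_ne_zero.2 H.index_ne_zero_of_finite
  have hh1 : (1 : ℝ) ≤ Nat.card H := by exact_mod_cast Nat.card_pos
  rw [hpairs] at hcs
  rw [AddSubgroup.card_top, Nat.card_eq_fintype_card] at hall
  simp only [AddSubgroup.mem_top, Finset.filter_true, Finset.card_product, Nat.cast_mul] at hall
  have hk : (0 : ℝ) < D.card := by exact_mod_cast hk0
  have hkv' : (D.card : ℝ) < Fintype.card G := by exact_mod_cast hkv
  have hv1 : (1 : ℝ) < Fintype.card G := by exact_mod_cast (by omega : 1 < Fintype.card G)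
  rw [← hv] at hall hkv' hv1 ⊢
  generalize (D.card : ℝ) = k at *
  generalize (Nat.card H : ℝ) = h at *
  generalize (H.index : ℝ) = m at *
  generalize (Λ : ℝ) = l at *
  have hscaled : k * (k * (m + h - 2)) ≤ k * (h * (m - 1) ^ 2) := by
    have hmul := mul_le_mul_of_nonneg_right hcs (sub_pos.2 hv1).le
    linear_combination hmul - (m - 1) * (h - 1) * hall
  have hreduced := le_of_mul_le_mul_left hscaled hk
  have hS : √(k * (h * m - 1) / (h * m - k)) ≤ m - 1 := by
    rw [Real.sqrt_le_left (by linarith), div_le_iff₀ (by linarith)]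
    linear_combination m * hreduced
  exact mul_le_mul_of_nonneg_left (by linarith) (by linarith)
end

section
/- Let G be a finite abelian group of order v, D ⊆ G a difference set with |D| = k, 0 < k < v, parameter Λ, and H a subgroup of G of order h with D ∩ H = ∅. Set S = √(k(v−1)/(v−k)). Then h·(S + 1) = v if and only if for every character γ of G that is trivial on H but not identically trivial, ∑_{d ∈ D} γ(d) = −k/S (as a complex number). -/
open scoped Classical

theorem sum_sub_eq_of_difference_set {G : Type*} [AddCommGroup G] [Fintype G]
    (D : Finset G) (Λ : ℕ)
    (hD : ∀ g : G, g ≠ 0 → ((D ×ˢ D).filter (fun p => p.1 - p.2 = g)).card = Λ) (f : G → ℂ) :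
    ∑ d ∈ D, ∑ d' ∈ D, f (d - d') = D.card * f 0 + Λ * (∑ g, f g - f 0) := by
  have h0 : ((D ×ˢ D).filter (fun p => p.1 - p.2 = 0)).card = D.card := by
    have : (D ×ˢ D).filter (fun p => p.1 - p.2 = 0) = D.diag := by
      ext ⟨a, b⟩
      simp only [Finset.mem_filter, Finset.mem_product, Finset.mem_diag, sub_eq_zero]
      constructor
      · rintro ⟨⟨ha, -⟩, hab⟩
        exact ⟨ha, hab⟩
      · rintro ⟨ha, rfl⟩
        exact ⟨⟨ha, ha⟩, rfl⟩
    rw [this, Finset.diag_card]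
  have hfib : ∀ g, ∑ p ∈ (D ×ˢ D).filter (fun p => p.1 - p.2 = g), f (p.1 - p.2) =
      ((D ×ˢ D).filter (fun p => p.1 - p.2 = g)).card * f g := by
    intro g
    rw [Finset.sum_congr rfl (g := fun _ => f g), Finset.sum_const, nsmul_eq_mul]
    intro p hp
    rw [(Finset.mem_filter.1 hp).2]
  rw [← Finset.sum_product', ← Finset.sum_fiberwise (D ×ˢ D) (fun p => p.1 - p.2)]
  simp_rw [hfib]
  rw [← Finset.add_sum_erase _ _ (Finset.mem_univ (0 : G)), h0,
    ← Finset.add_sum_erase _ f (Finset.mem_univ (0 : G)), add_sub_cancel_left, Finset.mul_sum]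
  congr 1
  refine Finset.sum_congr rfl fun g hg => ?_
  rw [hD g (Finset.ne_of_mem_erase hg)]

theorem card_mul_card_of_difference_set {G : Type*} [AddCommGroup G] [Fintype G]
    (D : Finset G) (Λ : ℕ)
    (hD : ∀ g : G, g ≠ 0 → ((D ×ˢ D).filter (fun p => p.1 - p.2 = g)).card = Λ) :
    (D.card : ℝ) * D.card = D.card + Λ * (Fintype.card G - 1) := by
  have h := sum_sub_eq_of_difference_set D Λ hD (fun _ => 1)
  simp only [Finset.sum_const, nsmul_eq_mul, mul_one, Finset.card_univ] at h
  exact_mod_cast h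

theorem norm_sq_sum_of_difference_set {G : Type*} [AddCommGroup G] [Fintype G]
    (D : Finset G) (Λ : ℕ)
    (hD : ∀ g : G, g ≠ 0 → ((D ×ˢ D).filter (fun p => p.1 - p.2 = g)).card = Λ)
    (γ : AddChar G ℂ) (hγ : γ ≠ 1) :
    ‖∑ d ∈ D, γ d‖ ^ 2 = D.card - Λ := by
  have h := sum_sub_eq_of_difference_set D Λ hD γ
  rw [AddChar.sum_eq_zero_of_ne_one hγ, AddChar.map_zero_eq_one] at h
  have h2 : ∑ d ∈ D, ∑ d' ∈ D, γ (d - d') =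
      (∑ d ∈ D, γ d) * (starRingEnd ℂ) (∑ d ∈ D, γ d) := by
    rw [map_sum, Finset.sum_mul_sum]
    refine Finset.sum_congr rfl fun d _ => Finset.sum_congr rfl fun d' _ => ?_
    rw [sub_eq_add_neg, AddChar.map_add_eq_mul, AddChar.map_neg_eq_conj]
  rw [h2, Complex.mul_conj'] at h
  have h3 : ((‖∑ d ∈ D, γ d‖ ^ 2 : ℝ) : ℂ) = ((D.card - Λ : ℝ) : ℂ) := by
    push_cast
    rw [h]
    ring
  exact_mod_cast h3

theorem eq_neg_of_norm_le_of_sum_eq {ι : Type*} (s : Finset ι) (a : ι → ℂ) (r : ℝ)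
    (hnorm : ∀ i ∈ s, ‖a i‖ ≤ r) (hsum : ∑ i ∈ s, a i = -(s.card * r : ℂ)) :
    ∀ i ∈ s, a i = -(r : ℂ) := by
  have hre : ∀ i ∈ s, 0 ≤ (a i).re + r := fun i hi => by
    have := (abs_le.1 ((Complex.abs_re_le_norm (a i)).trans (hnorm i hi))).1
    linarith
  have hzero : ∑ i ∈ s, ((a i).re + r) = 0 := by
    have := congrArg Complex.re hsum
    rw [Finset.sum_add_distrib, ← Complex.re_sum, this]
    simp
  intro i hi
  have h1 : (a i).re = -r := by
    linarith [(Finset.sum_eq_zero_iff_of_nonneg hre).1 hzero i hi]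
  have h2 : (a i).im = 0 := by
    have h3 := Complex.sq_norm (a i)
    rw [Complex.normSq_apply, h1] at h3
    have := hnorm i hi
    have := norm_nonneg (a i)
    have : (a i).im ^ 2 ≤ 0 := by nlinarith
    exact pow_eq_zero_iff two_ne_zero |>.1 (le_antisymm this (sq_nonneg _))
  apply Complex.ext <;> simp [h1, h2]

theorem exists_addChar_quotient {G : Type*} [AddCommGroup G] (H : AddSubgroup G)
    (γ : AddChar G ℂ) (hγ : ∀ x ∈ H, γ x = 1) :
    ∃ ψ : AddChar (G ⧸ H) ℂ, ∀ x : G, ψ (x : G ⧸ H) = γ x :=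
  ⟨AddChar.toAddMonoidHomEquiv.symm
    (QuotientAddGroup.lift H γ.toAddMonoidHom fun x hx => congrArg Additive.ofMul (hγ x hx)),
    fun _ => rfl⟩

theorem sum_nontrivial_quotient_addChar {G : Type*} [AddCommGroup G] [Fintype G]
    (D : Finset G) (H : AddSubgroup G) (hdisj : ∀ x ∈ D, x ∉ H) :
    ∑ ψ ∈ Finset.univ.erase (1 : AddChar (G ⧸ H) ℂ), ∑ d ∈ D, ψ (d : G ⧸ H) =
      -(D.card : ℂ) := by
  have h : ∑ ψ : AddChar (G ⧸ H) ℂ, ∑ d ∈ D, ψ (d : G ⧸ H) = 0 := by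
    rw [Finset.sum_comm]
    refine Finset.sum_eq_zero fun d hd => ?_
    rw [AddChar.sum_apply_eq_ite, if_neg]
    rw [QuotientAddGroup.eq_zero_iff]
    exact hdisj d hd
  rw [← Finset.add_sum_erase _ _ (Finset.mem_univ 1)] at h
  simp only [AddChar.one_apply, Finset.sum_const, nsmul_eq_mul, mul_one] at h
  exact eq_neg_of_add_eq_zero_right h

/-- With `D` a difference set in `G` and `H` a subgroup disjoint from `D`,
`h·(S+1) = v` iff every character of `G` that is trivial on `H` but not identically trivial
sums over `D` to `−k/S`. -/
theorem stmt_1 {G : Type*} [AddCommGroup G] [Fintype G]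
    (D : Finset G) (Λ : ℕ)
    (hk0 : 0 < D.card) (hkv : D.card < Fintype.card G)
    (hD : ∀ g : G, g ≠ 0 → ((D ×ˢ D).filter (fun p => p.1 - p.2 = g)).card = Λ)
    (H : AddSubgroup G) (hdisj : ∀ x ∈ D, x ∉ H) :
    (Nat.card H : ℝ) *
        (Real.sqrt (((D.card : ℝ) * ((Fintype.card G : ℝ) - 1)) /
            ((Fintype.card G : ℝ) - (D.card : ℝ))) + 1)
      = (Fintype.card G : ℝ) ↔
    ∀ γ : AddChar G ℂ, (∀ x ∈ H, γ x = 1) → (∃ x : G, γ x ≠ 1) →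
      ∑ d ∈ D, γ d =
        -((D.card : ℂ) /
          ((Real.sqrt (((D.card : ℝ) * ((Fintype.card G : ℝ) - 1)) /
              ((Fintype.card G : ℝ) - (D.card : ℝ))) : ℝ) : ℂ)) := by
  set k : ℝ := (D.card : ℝ) with hk
  set v : ℝ := (Fintype.card G : ℝ) with hv
  set S : ℝ := √(k * (v - 1) / (v - k)) with hS
  have hk1 : 1 ≤ k := by rw [hk]; exact_mod_cast hk0
  have hkv' : k < v := by rw [hk, hv]; exact_mod_cast hkv
  have hvk : 0 < v - k := sub_pos.2 hkv'
  have hv1 : 0 < v - 1 := by linarith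
  have hk_pos : 0 < k := by linarith
  have hSpos : 0 < S := Real.sqrt_pos.2 (by positivity)
  have hSsq : S ^ 2 = k * (v - 1) / (v - k) := Real.sq_sqrt (by positivity)
  have hcount : k * k = k + Λ * (v - 1) := card_mul_card_of_difference_set D Λ hD
  have horder : (k / S) ^ 2 = k - Λ := by
    rw [div_pow, hSsq]
    field_simp
    linarith
  set N : Finset (AddChar (G ⧸ H) ℂ) := Finset.univ.erase 1 with hN
  have hsum : ∑ ψ ∈ N, ∑ d ∈ D, ψ (d : G ⧸ H) = -(k : ℂ) := by
    rw [hk, Complex.ofReal_natCast]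
    exact sum_nontrivial_quotient_addChar D H hdisj
  have hpull : ∀ ψ ∈ N, ∃ x : G, ψ (x : G ⧸ H) ≠ 1 := by
    intro ψ hψ
    obtain ⟨q, hq⟩ := AddChar.ne_one_iff.1 (Finset.ne_of_mem_erase hψ)
    obtain ⟨x, rfl⟩ := QuotientAddGroup.mk_surjective q
    exact ⟨x, hq⟩
  have hnorm : ∀ ψ ∈ N, ‖∑ d ∈ D, ψ (d : G ⧸ H)‖ ≤ k / S := by
    intro ψ hψ
    have h := norm_sq_sum_of_difference_set D Λ hD
      (ψ.compAddMonoidHom (QuotientAddGroup.mk' H)) (AddChar.ne_one_iff.2 (hpull ψ hψ))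
    rw [← hk, ← horder] at h
    exact ((sq_eq_sq₀ (norm_nonneg _) (by positivity)).1 h).le
  have hindex : v = ((N.card : ℝ) + 1) * Nat.card H := by
    have h1 : N.card + 1 = Nat.card (G ⧸ H) := by
      rw [hN, Finset.card_erase_add_one (Finset.mem_univ _), Finset.card_univ,
        AddChar.card_eq, Nat.card_eq_fintype_card]
    have h2 := AddSubgroup.card_eq_card_quotient_mul_card_addSubgroup H
    rw [← h1, Nat.card_eq_fintype_card] at h2
    rw [hv, h2]
    push_cast
    ring
  have hH : (0 : ℝ) < Nat.card H := by exact_mod_cast Nat.card_pos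
  have hiff : (Nat.card H : ℝ) * (S + 1) = v ↔ S = N.card := by
    rw [hindex, mul_comm, mul_left_inj' hH.ne', add_left_inj]
  have hcast : -((D.card : ℂ) / (S : ℂ)) = -((k / S : ℝ) : ℂ) := by
    rw [hk]
    push_cast
    rfl
  rw [hiff, hcast]
  constructor
  · intro hSN γ hγ hγ1
    obtain ⟨ψ, hψ⟩ := exists_addChar_quotient H γ hγ
    have hψN : ψ ∈ N := by
      obtain ⟨x, hx⟩ := hγ1
      exact Finset.mem_erase.2 ⟨AddChar.ne_one_iff.2 ⟨x, by rwa [hψ]⟩, Finset.mem_univ _⟩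
    have h := eq_neg_of_norm_le_of_sum_eq N _ (k / S) hnorm ?_ ψ hψN
    · simpa only [hψ] using h
    · rw [hsum, ← Complex.ofReal_natCast, ← hSN, ← Complex.ofReal_mul,
        mul_div_cancel₀ _ hSpos.ne']
  · intro hall
    have hconst : ∀ ψ ∈ N, ∑ d ∈ D, ψ (d : G ⧸ H) = -((k / S : ℝ) : ℂ) := by
      intro ψ hψ
      refine hall (ψ.compAddMonoidHom (QuotientAddGroup.mk' H)) (fun x hx => ?_) (hpull ψ hψ)
      change ψ (x : G ⧸ H) = 1
      rw [(QuotientAddGroup.eq_zero_iff x).2 hx, AddChar.map_zero_eq_one]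
    rw [Finset.sum_congr rfl hconst, Finset.sum_const, nsmul_eq_mul] at hsum
    have hreal : (N.card : ℝ) * -(k / S) = -k := by exact_mod_cast hsum
    field_simp at hreal
    nlinarith
end

section
/- Let G be a finite abelian group of order v, D ⊆ G a difference set with |D| = k, 0 < k < v, parameter Λ, and H a subgroup of G of order h with D ∩ H = ∅. Set S = √(k(v−1)/(v−k)). Then h·(S + 1) = v if and only if for every g ∈ G with g ∉ H, the cardinality of the set {x ∈ H : g + x ∈ D} satisfies |{x ∈ H : g + x ∈ D}| · S = k (as real numbers). -/
open scoped Classical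

/-- The number of representations `p.1 - p.2 = z` in `D`, as a sum of products of indicators. -/
lemma sum_indicator_mul_shift {G : Type*} [AddCommGroup G] [Fintype G] (D : Finset G) (z : G) :
    ∑ g : G, (if g + z ∈ D then (1 : ℝ) else 0) * (if g ∈ D then 1 else 0)
      = ((D ×ˢ D).filter (fun p => p.1 - p.2 = z)).card := by
  simp only [mul_ite, mul_one, mul_zero, ← ite_and]
  rw [Finset.sum_boole]
  norm_cast
  refine Finset.card_bij' (fun g _ => (g + z, g)) (fun p _ => p.2) ?_ ?_ ?_ ?_
  · intro g hg
    simp at hg ⊢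
    tauto
  · rintro ⟨a, b⟩ hp
    simp at hp ⊢
    obtain ⟨⟨ha, hb⟩, rfl⟩ := hp
    simpa [hb] using ha
  · intro g _
    rfl
  · rintro ⟨a, b⟩ hp
    simp at hp ⊢
    rw [← hp.2]
    abel

lemma sum_indicator_shift {G : Type*} [AddCommGroup G] [Fintype G] (D : Finset G) (x : G) :
    ∑ g : G, (if g + x ∈ D then (1 : ℝ) else 0) = D.card := by
  exact (Equiv.sum_comp (Equiv.addRight x) (fun g => if g ∈ D then (1 : ℝ) else 0)).trans (by simp)

/-- The second moment of the intersection numbers of a difference set with the cosets of `H`. -/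
lemma sum_sq_coset_inter {G : Type*} [AddCommGroup G] [Fintype G] (D : Finset G) (Λ : ℕ)
    (hD : ∀ g : G, g ≠ 0 → ((D ×ˢ D).filter (fun p => p.1 - p.2 = g)).card = Λ)
    (H : AddSubgroup G) :
    ∑ g : G, (∑ x : H, if g + x ∈ D then (1 : ℝ) else 0) ^ 2
      = Nat.card H * (D.card + Λ * (Nat.card H - 1)) := by
  set A : G → ℝ := fun z => ((D ×ˢ D).filter (fun p => p.1 - p.2 = z)).card with hA
  have hA0 : A 0 = D.card := by
    rw [hA]
    simp only [← sum_indicator_mul_shift]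
    simp
  have hsumA : ∑ z : H, A z = D.card + Λ * (Nat.card H - 1) := by
    rw [← Finset.add_sum_erase _ _ (Finset.mem_univ (0 : H)), ZeroMemClass.coe_zero, hA0,
      Finset.sum_congr rfl (g := fun _ => (Λ : ℝ))]
    · rw [Finset.sum_const, Finset.card_erase_of_mem (Finset.mem_univ _), Finset.card_univ,
        nsmul_eq_mul, Nat.cast_sub Fintype.card_pos, Nat.card_eq_fintype_card]
      push_cast
      ring
    · intro z hz
      simp only [hA]
      rw [hD]
      simpa using hz
  have hxy (x y : H) : ∑ g : G, (if g + x ∈ D then (1 : ℝ) else 0) *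
      (if g + y ∈ D then 1 else 0) = A (x - y : H) := by
    simp only [hA]
    rw [← sum_indicator_mul_shift, ← Equiv.sum_comp (Equiv.addRight (y : G))
      (fun g => (if g + ((x - y : H) : G) ∈ D then (1 : ℝ) else 0) * (if g ∈ D then 1 else 0))]
    refine Finset.sum_congr rfl fun g _ => ?_
    rw [Equiv.coe_addRight, AddSubgroup.coe_sub, add_assoc g (y : G), add_sub_cancel]
  simp only [sq, Finset.sum_mul_sum]
  rw [Finset.sum_comm]
  simp_rw [Finset.sum_comm (s := (Finset.univ : Finset G)), hxy]
  rw [Finset.sum_comm]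
  have hy (y : H) : ∑ x : H, A (x - y : H) = D.card + Λ * (Nat.card H - 1) := by
    rw [← hsumA]
    exact Equiv.sum_comp (Equiv.subRight y) (fun z : H => A z)
  simp_rw [hy]
  rw [Finset.sum_const, Finset.card_univ, nsmul_eq_mul, Nat.card_eq_fintype_card]

/-- The parameter relation `Λ (v - 1) = k (k - 1)` of a difference set. -/
lemma difference_set_relation {G : Type*} [AddCommGroup G] [Fintype G] (D : Finset G) (Λ : ℕ)
    (hD : ∀ g : G, g ≠ 0 → ((D ×ˢ D).filter (fun p => p.1 - p.2 = g)).card = Λ) :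
    (Λ : ℝ) * (Fintype.card G - 1) = D.card * (D.card - 1) := by
  have h := sum_sq_coset_inter D Λ hD ⊤
  have h1 (g : G) : ∑ x : (⊤ : AddSubgroup G), (if g + x ∈ D then (1 : ℝ) else 0) = D.card := by
    rw [← sum_indicator_shift D g]
    simp_rw [add_comm g]
    exact Equiv.sum_comp AddSubgroup.topEquiv.toEquiv
      (fun x : G => if x + g ∈ D then (1 : ℝ) else 0)
  simp only [h1, AddSubgroup.card_top] at h
  rw [Nat.card_eq_fintype_card, Finset.sum_const, Finset.card_univ, nsmul_eq_mul] at h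
  have hv : (Fintype.card G : ℝ) ≠ 0 := Nat.cast_ne_zero.mpr Fintype.card_ne_zero
  linarith [mul_left_cancel₀ hv h]

/-- With `D` a difference set in `G` and `H` a subgroup disjoint from `D`,
`h·(S+1) = v` iff for every `g ∉ H` the set `{x ∈ H : g + x ∈ D}` has cardinality `k/S`,
i.e. its cardinality times `S` equals `k`. -/
theorem stmt_2 {G : Type*} [AddCommGroup G] [Fintype G]
    (D : Finset G) (Λ : ℕ)
    (hk0 : 0 < D.card) (hkv : D.card < Fintype.card G)
    (hD : ∀ g : G, g ≠ 0 → ((D ×ˢ D).filter (fun p => p.1 - p.2 = g)).card = Λ)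
    (H : AddSubgroup G) (hdisj : ∀ x ∈ D, x ∉ H) :
    (Nat.card H : ℝ) *
        (Real.sqrt (((D.card : ℝ) * ((Fintype.card G : ℝ) - 1)) /
            ((Fintype.card G : ℝ) - (D.card : ℝ))) + 1)
      = (Fintype.card G : ℝ) ↔
    ∀ g : G, g ∉ H →
      (Nat.card {x : G // x ∈ H ∧ g + x ∈ D} : ℝ) *
          Real.sqrt (((D.card : ℝ) * ((Fintype.card G : ℝ) - 1)) /
            ((Fintype.card G : ℝ) - (D.card : ℝ)))
        = (D.card : ℝ) := by
  set k : ℝ := (D.card : ℝ) with hk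
  set v : ℝ := (Fintype.card G : ℝ) with hv
  set h : ℝ := (Nat.card H : ℝ) with hh
  set S : ℝ := Real.sqrt ((k * (v - 1)) / (v - k)) with hS
  have hkpos : 0 < k := by simpa [hk] using hk0
  have hkv' : k < v := by simpa [hk, hv] using hkv
  have hv1 : 1 < v := by
    have : 1 < Fintype.card G := by omega
    rw [hv]
    exact_mod_cast this
  have hhpos : 0 < h := by
    rw [hh]
    exact_mod_cast Nat.card_pos
  have hS0 : 0 ≤ S := Real.sqrt_nonneg _
  have hS2 : S ^ 2 * (v - k) = k * (v - 1) := by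
    rw [hS, Real.sq_sqrt (div_nonneg (mul_nonneg hkpos.le (by linarith)) (by linarith))]
    exact div_mul_cancel₀ _ (by linarith)
  set n : G → ℝ := fun g => ∑ x : H, if g + x ∈ D then (1 : ℝ) else 0 with hn
  have hcard (g : G) : (Nat.card {x : G // x ∈ H ∧ g + x ∈ D} : ℝ) = n g := by
    simp only [hn]
    rw [Finset.sum_boole, ← Fintype.card_subtype, ← Nat.card_eq_fintype_card]
    exact congrArg _ (Nat.card_congr
      (Equiv.subtypeSubtypeEquivSubtypeInter (fun x => x ∈ H) (fun x => g + x ∈ D)).symm)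
  have hnH (g : G) (hg : g ∈ H) : n g = 0 :=
    Finset.sum_eq_zero fun x _ => if_neg fun hx => hdisj _ hx (H.add_mem hg x.2)
  have hsum : ∑ g : G, n g = h * k := by
    simp only [hn]
    rw [Finset.sum_comm]
    simp_rw [sum_indicator_shift]
    rw [Finset.sum_const, Finset.card_univ, nsmul_eq_mul, hh, Nat.card_eq_fintype_card]
  have hsq : ∑ g : G, n g ^ 2 = h * (k + Λ * (h - 1)) := sum_sq_coset_inter D Λ hD H
  have hrel : (Λ : ℝ) * (v - 1) = k * (k - 1) := difference_set_relation D Λ hD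
  have hH : ∑ g : G, (if g ∈ H then (0 : ℝ) else 1) = v - h := by
    have h1 : ∑ g : G, (if g ∈ H then (1 : ℝ) else 0) = h := by
      rw [Finset.sum_boole, ← Fintype.card_subtype, ← Nat.card_eq_fintype_card]
    have h2 : ∑ g : G, (1 : ℝ) = v := by simp [hv]
    rw [← h1, ← h2, ← Finset.sum_sub_distrib]
    exact Finset.sum_congr rfl fun g _ => by split_ifs <;> simp
  simp only [hcard]
  constructor
  · intro hA
    have hE : h * S ^ 2 = k * (h + S - 1) := by
      rw [← hA] at hS2
      have : (S + 1) * (h * S ^ 2) = (S + 1) * (k * (h + S - 1)) := by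
        linear_combination hS2
      exact mul_left_cancel₀ (by linarith) this
    have hvar : ∑ g : G, (n g * S - k * (if g ∈ H then 0 else 1)) ^ 2 = 0 := by
      have h1 : ∑ g : G, (n g * S - k * (if g ∈ H then 0 else 1)) ^ 2
          = S ^ 2 * (h * (k + Λ * (h - 1))) - 2 * S * k * (h * k) + k ^ 2 * (v - h) := by
        rw [← hsq, ← hsum, ← hH, Finset.mul_sum, Finset.mul_sum, Finset.mul_sum,
          ← Finset.sum_sub_distrib, ← Finset.sum_add_distrib]
        refine Finset.sum_congr rfl fun g _ => ?_
        by_cases hg : g ∈ H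
        · simp [hg, hnH g hg]
        · simp only [hg, if_false]
          ring
      rw [h1]
      refine (mul_eq_zero.mp ?_).resolve_left (sub_ne_zero.mpr hv1.ne')
      rw [← hA] at hrel ⊢
      linear_combination S ^ 2 * h * (h - 1) * hrel + k * h * S * hE
    intro g hg
    have := (Finset.sum_eq_zero_iff_of_nonneg fun g _ => sq_nonneg _).mp hvar g (Finset.mem_univ g)
    simp only [hg, if_false, mul_one] at this
    linarith [pow_eq_zero_iff two_ne_zero |>.mp this]
  · intro hB
    have h1 : h * k * S = k * (v - h) := by
      rw [← hsum, ← hH, Finset.sum_mul, Finset.mul_sum]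
      refine Finset.sum_congr rfl fun g _ => ?_
      by_cases hg : g ∈ H
      · simp [hg, hnH g hg]
      · simp [hg, hB g hg]
    have h2 : k * (h * (S + 1)) = k * v := by linear_combination h1
    exact mul_left_cancel₀ hkpos.ne' h2
end

section
/- Let G be a finite abelian group of order v, D ⊆ G a difference set with |D| = k, 0 < k < v, parameter Λ, and H a subgroup of G of order h with D ∩ H = ∅ and h·(S + 1) = v, where S = √(k(v−1)/(v−k)). Then there exist natural numbers s and m such that (s : ℝ) = S, k = s·m, and k = Λ + m²; in particular S is an integer dividing k and the order k − Λ of D is a perfect square. -/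
open scoped Classical

/-- The counting identity `k² = k + (v - 1)Λ` for a difference set. -/
theorem card_sq_eq_of_differenceSet {G : Type*} [AddCommGroup G] [Fintype G]
    (D : Finset G) (Λ : ℕ)
    (hD : ∀ g : G, g ≠ 0 → ((D ×ˢ D).filter (fun p => p.1 - p.2 = g)).card = Λ) :
    D.card * D.card = D.card + (Fintype.card G - 1) * Λ := by
  have hzero : ((D ×ˢ D).filter (fun p => p.1 - p.2 = 0)).card = D.card := by
    simp only [sub_eq_zero]
    rw [← Finset.diag_card D]
    congr 1
    ext p
    grind
  rw [← Finset.card_product, Finset.card_eq_sum_card_fiberwise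
    (f := fun p : G × G => p.1 - p.2) (t := Finset.univ) (by simp),
    ← Finset.add_sum_erase _ _ (Finset.mem_univ (0 : G)), hzero,
    Finset.sum_congr rfl fun g hg => hD g (Finset.ne_of_mem_erase hg)]
  simp [Finset.card_erase_of_mem]

/-- If `D` is a difference set with parameter `Λ` in `G`, `H` is a subgroup
disjoint from `D` with `h·(S+1) = v`, then `S` is an integer `s` dividing `k` (say `k = s·m`),
and the order `k − Λ` of `D` is the perfect square `m²` (i.e. `k = Λ + m²`). -/
theorem stmt_3 {G : Type*} [AddCommGroup G] [Fintype G]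
    (D : Finset G) (Λ : ℕ)
    (hk0 : 0 < D.card) (hkv : D.card < Fintype.card G)
    (hD : ∀ g : G, g ≠ 0 → ((D ×ˢ D).filter (fun p => p.1 - p.2 = g)).card = Λ)
    (H : AddSubgroup G) (hdisj : ∀ x ∈ D, x ∉ H)
    (hfine : (Nat.card H : ℝ) *
        (Real.sqrt (((D.card : ℝ) * ((Fintype.card G : ℝ) - 1)) /
            ((Fintype.card G : ℝ) - (D.card : ℝ))) + 1)
      = (Fintype.card G : ℝ)) :
    ∃ s m : ℕ,
      (s : ℝ) = Real.sqrt (((D.card : ℝ) * ((Fintype.card G : ℝ) - 1)) /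
          ((Fintype.card G : ℝ) - (D.card : ℝ))) ∧
      D.card = s * m ∧ D.card = Λ + m ^ 2 := by
  have hcount := card_sq_eq_of_differenceSet D Λ hD
  have hlag : Fintype.card G = Nat.card H * H.index := by
    rw [H.card_mul_index, Nat.card_eq_fintype_card]
  have hH : (0 : ℝ) < Nat.card H := by exact_mod_cast Nat.card_pos
  set k := D.card
  set v := Fintype.card G
  have hkR : (0 : ℝ) < k := by exact_mod_cast hk0
  have hvkR : (0 : ℝ) < (v : ℝ) - k := by
    rw [sub_pos]
    exact_mod_cast hkv
  have hvR : (0 : ℝ) < (v : ℝ) - 1 := by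
    rw [sub_pos]
    exact_mod_cast (by lia : 1 < v)
  have hcountR : (k : ℝ) * k = k + ((v : ℝ) - 1) * Λ := by
    have h := congrArg (Nat.cast (R := ℝ)) hcount
    rwa [Nat.cast_mul, Nat.cast_add, Nat.cast_mul, Nat.cast_sub (by lia), Nat.cast_one] at h
  have harg : 0 < (k : ℝ) * ((v : ℝ) - 1) / ((v : ℝ) - k) := by positivity
  have hSpos := Real.sqrt_pos.2 harg
  have hSsq := Real.sq_sqrt harg.le
  set S := Real.sqrt ((k : ℝ) * ((v : ℝ) - 1) / ((v : ℝ) - k))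
  have hindex : S + 1 = H.index := by
    apply mul_left_cancel₀ hH.ne'
    rw [hfine, hlag, Nat.cast_mul]
  obtain ⟨s, hs⟩ : ∃ s : ℕ, H.index = s + 1 :=
    Nat.exists_eq_succ_of_ne_zero H.index_ne_zero_of_finite
  have hsS : (s : ℝ) = S := by
    rw [hs, Nat.cast_add_one] at hindex
    linarith
  rw [eq_div_iff hvkR.ne', ← hsS] at hSsq
  have hs0 : (0 : ℝ) < s := hsS ▸ hSpos
  have hkey : (k : ℝ) ^ 2 = s ^ 2 * (k - Λ) := by
    apply mul_right_cancel₀ hvR.ne'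
    linear_combination -(k : ℝ) * hSsq - (s : ℝ) ^ 2 * hcountR
  have hdvd : s ∣ k := by
    rw [← Nat.pow_dvd_pow_iff two_ne_zero, ← Int.natCast_dvd_natCast]
    refine ⟨(k : ℤ) - Λ, ?_⟩
    push_cast
    exact_mod_cast hkey
  obtain ⟨m, hm⟩ := hdvd
  refine ⟨s, m, hsS, hm, ?_⟩
  have hmR : (k : ℝ) = s * m := by exact_mod_cast hm
  have horder : (m : ℝ) ^ 2 = k - Λ := by
    apply mul_left_cancel₀ (pow_pos hs0 2).ne'
    rw [← hkey, hmR, mul_pow]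
  have : (k : ℝ) = Λ + (m : ℝ) ^ 2 := by linarith
  exact_mod_cast this
end

section
/- Let G be a finite abelian group of order v, D ⊆ G a difference set with |D| = k, 0 < k < v, parameter Λ, and H a subgroup of G of order h such that D is H-fine with associated natural number s. Let H⊥ be the set of characters of G trivial on H. For each character γ of G define: Φ_γ, the matrix with rows indexed by D and columns indexed by H⊥, with Φ_γ(d, γ') = k^{−1/2}·γ(d)·γ'(d); E_γ, the matrix with rows indexed by D and columns indexed by the nonidentity cosets of H, with E_γ(d, ḡ) = √(s/k)·γ(d) if d + H = ḡ and 0 otherwise; and Ψ, the matrix with rows indexed by the nonidentity cosets of H and columns indexed by H⊥, with Ψ(ḡ, γ') = s^{−1/2}·γ'(g) for any representative g of ḡ. Then Ψ is well defined (independent of the choice of representative), Φ_γ = E_γ·Ψ for every γ, and the columns of Ψ form a regular s-simplex: for distinct γ₁, γ₂ ∈ H⊥, ∑_{ḡ ≠ 0̄} conj(Ψ(ḡ,γ₁))·Ψ(ḡ,γ₂) = −1/s, while each column of Ψ has unit norm. -/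
open scoped Classical
open Matrix

/-- The matrix `E_γ` with rows indexed by `D` and columns indexed by the nonidentity cosets
of `H`: entry `√(s/k)·γ(d)` at `(d, ḡ)` when `d + H = ḡ`, and `0` otherwise. -/
noncomputable def Efun {G : Type*} [AddCommGroup G] (H : AddSubgroup G) (D : Finset G)
    (s : ℕ) (γ : AddChar G ℂ) : Matrix {d : G // d ∈ D} {c : G ⧸ H // c ≠ 0} ℂ :=
  fun d c => if (QuotientAddGroup.mk d.1 : G ⧸ H) = c.1
    then ((Real.sqrt ((s : ℝ) / (D.card : ℝ)) : ℝ) : ℂ) * γ d.1 else 0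

/-- The matrix `Φ_γ`, rows indexed by `D`, columns indexed by `H⊥` (characters trivial on `H`),
with entry `k^{-1/2}·γ(d)·γ'(d)`. -/
noncomputable def Phifun {G : Type*} [AddCommGroup G] (H : AddSubgroup G) (D : Finset G)
    (γ : AddChar G ℂ) :
    Matrix {d : G // d ∈ D} {γ' : AddChar G ℂ // ∀ x ∈ H, γ' x = 1} ℂ :=
  fun d γ' => (((Real.sqrt (D.card : ℝ))⁻¹ : ℝ) : ℂ) * γ d.1 * γ'.1 d.1

/-- The matrix `Ψ`, rows indexed by the nonidentity cosets of `H`, columns indexed by `H⊥`,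
with entry `s^{-1/2}·γ'(g)` for a representative `g` of the row coset. -/
noncomputable def Psifun {G : Type*} [AddCommGroup G] (H : AddSubgroup G) (s : ℕ) :
    Matrix {c : G ⧸ H // c ≠ 0} {γ' : AddChar G ℂ // ∀ x ∈ H, γ' x = 1} ℂ :=
  fun c γ' => (((Real.sqrt (s : ℝ))⁻¹ : ℝ) : ℂ) * γ'.1 c.1.out

theorem AddChar.eq_of_mk_eq {G M : Type*} [AddCommGroup G] [Monoid M] {H : AddSubgroup G}
    {χ : AddChar G M} (hχ : ∀ x ∈ H, χ x = 1) {g g' : G}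
    (h : (QuotientAddGroup.mk g : G ⧸ H) = QuotientAddGroup.mk g') : χ g = χ g' := by
  have h1 : χ (-g + g') = 1 := hχ _ (QuotientAddGroup.eq.1 h)
  have h2 : χ (g + (-g + g')) = χ g' := by rw [add_neg_cancel_left]
  rw [← h2, AddChar.map_add_eq_mul, h1, mul_one]

theorem AddChar.eq_out_mk {G M : Type*} [AddCommGroup G] [Monoid M] {H : AddSubgroup G}
    {χ : AddChar G M} (hχ : ∀ x ∈ H, χ x = 1) (g : G) :
    χ (QuotientAddGroup.mk g : G ⧸ H).out = χ g :=
  AddChar.eq_of_mk_eq hχ (QuotientAddGroup.out_eq' _)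

/-- A nontrivial character that is trivial on `H` sums to zero over the cosets of `H`. -/
theorem AddChar.sum_quotient_out_eq_zero {G R : Type*} [AddCommGroup G] [CommRing R] [IsDomain R]
    {H : AddSubgroup G} [Fintype (G ⧸ H)] {χ : AddChar G R} (hχ : ∀ x ∈ H, χ x = 1)
    (hne : χ ≠ 1) : ∑ c : G ⧸ H, χ c.out = 0 := by
  obtain ⟨a, ha⟩ := AddChar.ne_one_iff.1 hne
  have key : (∑ c : G ⧸ H, χ c.out) * χ a = ∑ c : G ⧸ H, χ c.out := by
    rw [Finset.sum_mul]
    refine Fintype.sum_equiv (Equiv.addRight (QuotientAddGroup.mk a : G ⧸ H)) _ _ fun c => ?_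
    rw [← AddChar.map_add_eq_mul, ← AddChar.eq_out_mk hχ (c.out + a), QuotientAddGroup.mk_add,
      QuotientAddGroup.out_eq']
    rfl
  by_contra hS
  exact ha (mul_left_cancel₀ hS (key.trans (mul_one _).symm))

theorem star_Psifun_mul_Psifun {G : Type*} [AddCommGroup G] [Finite G] {H : AddSubgroup G}
    {s : ℕ} (c : {c : G ⧸ H // c ≠ 0})
    (γ₁ γ₂ : {γ' : AddChar G ℂ // ∀ x ∈ H, γ' x = 1}) :
    star (Psifun H s c γ₁) * Psifun H s c γ₂ =
      (s : ℂ)⁻¹ * (γ₁.1⁻¹ * γ₂.1) c.1.out := by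
  have hs : (((Real.sqrt (s : ℝ))⁻¹ : ℝ) : ℂ) * (((Real.sqrt (s : ℝ))⁻¹ : ℝ) : ℂ)
      = (s : ℂ)⁻¹ := by
    rw [← Complex.ofReal_mul, ← mul_inv, Real.mul_self_sqrt (Nat.cast_nonneg s)]
    push_cast
    rfl
  have hc : star (γ₁.1 c.1.out) = γ₁.1 (-c.1.out) := (AddChar.map_neg_eq_conj _ _).symm
  have hr : star (((Real.sqrt (s : ℝ))⁻¹ : ℝ) : ℂ) = (((Real.sqrt (s : ℝ))⁻¹ : ℝ) : ℂ) :=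
    Complex.conj_ofReal _
  simp only [Psifun]
  rw [star_mul', hc, hr, AddChar.mul_apply, AddChar.inv_apply, ← hs]
  ring

theorem Phifun_eq_Efun_mul_Psifun {G : Type*} [AddCommGroup G] [Fintype G] {D : Finset G}
    {H : AddSubgroup G} {s : ℕ} (hs : s ≠ 0) (hdisj : ∀ x ∈ D, x ∉ H) (γ : AddChar G ℂ) :
    Phifun H D γ = Efun H D s γ * Psifun H s := by
  ext d γ'
  have hd : (QuotientAddGroup.mk d.1 : G ⧸ H) ≠ 0 := fun h =>
    hdisj d.1 d.2 ((QuotientAddGroup.eq_zero_iff _).1 h)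
  rw [Matrix.mul_apply, Finset.sum_eq_single ⟨QuotientAddGroup.mk d.1, hd⟩]
  · have hs' : Real.sqrt (s : ℝ) ≠ 0 := by positivity
    have hsqrt : Real.sqrt ((s : ℝ) / D.card) * (Real.sqrt (s : ℝ))⁻¹
        = (Real.sqrt (D.card : ℝ))⁻¹ := by
      rw [Real.sqrt_div (Nat.cast_nonneg s)]
      field_simp
    simp only [Efun, Phifun, Psifun, if_true]
    rw [AddChar.eq_out_mk γ'.2, ← hsqrt, Complex.ofReal_mul]
    ring
  · intro c _ hc
    have : (QuotientAddGroup.mk d.1 : G ⧸ H) ≠ c.1 := fun h => hc (Subtype.ext h.symm)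
    simp [Efun, this]
  · simp

/-- If `D` is an `H`-fine difference set with associated natural number `s`,
then `Ψ` is well defined (characters in `H⊥` are constant on cosets of `H`), `Φ_γ = E_γ·Ψ`
for every character `γ`, and the columns of `Ψ` form a regular `s`-simplex: distinct columns
have inner product `−1/s` while each column has unit norm. -/
theorem stmt_6 {G : Type*} [AddCommGroup G] [Fintype G]
    (D : Finset G) (Λ : ℕ)
    (hk0 : 0 < D.card) (hkv : D.card < Fintype.card G)
    (hD : ∀ g : G, g ≠ 0 → ((D ×ˢ D).filter (fun p => p.1 - p.2 = g)).card = Λ)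
    (H : AddSubgroup G) (s : ℕ)
    (hdisj : ∀ x ∈ D, x ∉ H)
    (hfine : Nat.card H * (s + 1) = Fintype.card G)
    (hS : s ^ 2 * (Fintype.card G - D.card) = D.card * (Fintype.card G - 1)) :
    (∀ γ' : AddChar G ℂ, (∀ x ∈ H, γ' x = 1) →
      ∀ g g' : G, (QuotientAddGroup.mk g : G ⧸ H) = QuotientAddGroup.mk g' → γ' g = γ' g') ∧
    (∀ γ : AddChar G ℂ, Phifun H D γ = Efun H D s γ * Psifun H s) ∧
    (∀ γ₁ γ₂ : {γ' : AddChar G ℂ // ∀ x ∈ H, γ' x = 1}, γ₁ ≠ γ₂ →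
      ∑ c : {c : G ⧸ H // c ≠ 0}, star (Psifun H s c γ₁) * Psifun H s c γ₂
        = -(1 / (s : ℂ))) ∧
    (∀ γ' : {γ' : AddChar G ℂ // ∀ x ∈ H, γ' x = 1},
      ∑ c : {c : G ⧸ H // c ≠ 0}, star (Psifun H s c γ') * Psifun H s c γ' = 1) := by
  have hs : s ≠ 0 := by
    rintro rfl
    have : 0 < D.card * (Fintype.card G - 1) := Nat.mul_pos hk0 (by omega)
    simp only [ne_eq, OfNat.ofNat_ne_zero, not_false_eq_true, zero_pow, zero_mul] at hS
    omega
  have hs' : (s : ℂ) ≠ 0 := Nat.cast_ne_zero.2 hs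
  have hcard : Nat.card (G ⧸ H) = s + 1 := by
    have h := AddSubgroup.card_eq_card_quotient_mul_card_addSubgroup H
    rw [Nat.card_eq_fintype_card (α := G), ← hfine, mul_comm] at h
    exact (Nat.eq_of_mul_eq_mul_right Nat.card_pos h).symm
  refine ⟨fun γ' h g g' => AddChar.eq_of_mk_eq h, Phifun_eq_Efun_mul_Psifun hs hdisj,
    fun γ₁ γ₂ hne => ?_, fun γ' => ?_⟩
  · have htriv : ∀ x ∈ H, (γ₁.1⁻¹ * γ₂.1) x = 1 := fun x hx => by
      rw [AddChar.mul_apply, AddChar.inv_apply, γ₁.2 _ (H.neg_mem hx), γ₂.2 x hx, mul_one]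
    have hsum := AddChar.sum_quotient_out_eq_zero htriv
      fun h => hne (Subtype.ext (inv_mul_eq_one.1 h))
    rw [Fintype.sum_eq_add_sum_subtype_ne _ (0 : G ⧸ H), ← QuotientAddGroup.mk_zero,
      AddChar.eq_out_mk htriv, AddChar.map_zero_eq_one] at hsum
    simp_rw [star_Psifun_mul_Psifun]
    rw [← Finset.mul_sum, one_div, ← mul_neg_one]
    congr 1
    convert eq_neg_of_add_eq_zero_right hsum
  · simp_rw [star_Psifun_mul_Psifun, inv_mul_cancel, AddChar.one_apply]
    have : Fintype.card {c : G ⧸ H // c ≠ 0} = s := by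
      rw [Fintype.card_subtype_compl, Fintype.card_subtype_eq, ← Nat.card_eq_fintype_card, hcard,
        Nat.add_sub_cancel]
    rw [Finset.sum_const, Finset.card_univ, this, nsmul_eq_mul, mul_one, mul_inv_cancel₀ hs']
end

section
/- Let G be a finite abelian group of order v, D ⊆ G a difference set with |D| = k, 0 < k < v, parameter Λ, and H a subgroup of G of order h such that D is H-fine with associated natural number s. Suppose D is composite: there exist A ⊆ G with |A| = s and a difference set B for H such that for every g ∈ G the number of ordered pairs (a,b) ∈ A × B with a + b = g equals 1 if g ∈ D and 0 otherwise. Then: |B|·s = k; A ∩ H = ∅; no nonzero element of H can be written as a − a' with a, a' ∈ A; for every g ∈ G with g ∉ H, the number of ordered pairs (a,a') ∈ A × A with a − a' = g, multiplied by h, equals s − 1 (so A is a relative difference set RDS(s+1, h, s, (s−1)/h) disjoint from H); and v − k divides k − 1. -/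
open scoped Classical

namespace GroupRing

open AddMonoidAlgebra Finset

variable {G : Type*}

/-- The element `∑ x ∈ S, [x]` of the integral group ring. -/
noncomputable def ofFinset (S : Finset G) : AddMonoidAlgebra ℤ G := ∑ x ∈ S, single x 1

lemma coeff_ofFinset (S : Finset G) (g : G) :
    (ofFinset S).coeff g = if g ∈ S then 1 else 0 := by
  simp [ofFinset, coeff_sum, Finsupp.single_apply]

variable [AddCommGroup G]

/-- The involution `[x] ↦ [-x]` of the integral group ring. -/
noncomputable def inv : AddMonoidAlgebra ℤ G →+* AddMonoidAlgebra ℤ G :=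
  mapDomainRingHom ℤ (negAddMonoidHom : G →+ G)

/-- The augmentation `[x] ↦ 1` of the integral group ring. -/
noncomputable def aug : AddMonoidAlgebra ℤ G →+* ℤ :=
  (AddMonoidAlgebra.lift ℤ ℤ G (1 : Multiplicative G →* ℤ)).toRingHom

lemma inv_ofFinset (S : Finset G) : inv (ofFinset S) = ∑ x ∈ S, single (-x) (1 : ℤ) := by
  simp [inv, ofFinset, map_sum]

lemma aug_ofFinset (S : Finset G) : aug (ofFinset S) = S.card := by
  simp [aug, ofFinset, map_sum]

lemma aug_inv_ofFinset (S : Finset G) : aug (inv (ofFinset S)) = S.card := by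
  rw [inv_ofFinset]
  simp [aug, map_sum]

lemma coeff_intCast_mul (z : ℤ) (f : AddMonoidAlgebra ℤ G) (g : G) :
    ((z : AddMonoidAlgebra ℤ G) * f).coeff g = z * f.coeff g := by
  rw [← zsmul_eq_mul, coeff_smul, Finsupp.smul_apply, smul_eq_mul]

lemma coeff_one_eq (g : G) :
    (1 : AddMonoidAlgebra ℤ G).coeff g = if g = 0 then 1 else 0 := by
  simp [one_def, Finsupp.single_apply, eq_comm]

lemma coeff_ofFinset_mul (S T : Finset G) (g : G) :
    (ofFinset S * ofFinset T).coeff g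
      = ((S ×ˢ T).filter (fun p => p.1 + p.2 = g)).card := by
  simp [ofFinset, Finset.sum_mul_sum, ← Finset.sum_product', coeff_sum, Finsupp.single_apply,
    Finset.sum_boole]

lemma coeff_ofFinset_mul_inv (S T : Finset G) (g : G) :
    (ofFinset S * inv (ofFinset T)).coeff g
      = ((S ×ˢ T).filter (fun p => p.1 - p.2 = g)).card := by
  rw [inv_ofFinset]
  simp [ofFinset, Finset.sum_mul_sum, ← Finset.sum_product', coeff_sum, Finsupp.single_apply,
    Finset.sum_boole, sub_eq_add_neg]

lemma card_filter_sub_eq_zero (S : Finset G) :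
    ((S ×ˢ S).filter (fun p => p.1 - p.2 = 0)).card = S.card := by
  rw [← Finset.diag_card S]
  congr 1
  ext ⟨a, b⟩
  simp only [mem_filter, mem_product, mem_diag, sub_eq_zero]
  constructor
  · rintro ⟨⟨h, -⟩, h'⟩
    exact ⟨h, h'⟩
  · rintro ⟨h, rfl⟩
    exact ⟨⟨h, h⟩, rfl⟩

/-- A difference set `S` for a subgroup `K` with parameter `μ` satisfies
`S S⁻¹ = (|S| - μ) + μ K` in the group ring. -/
lemma ofFinset_mul_inv_self [Fintype G] (K : AddSubgroup G) (S : Finset G) (μ : ℕ)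
    (hSK : ∀ x ∈ S, x ∈ K)
    (hS : ∀ x : G, x ∈ K → x ≠ 0 → ((S ×ˢ S).filter (fun p => p.1 - p.2 = x)).card = μ) :
    ofFinset S * inv (ofFinset S) = ((S.card - μ : ℤ) : AddMonoidAlgebra ℤ G) * 1
      + ((μ : ℤ) : AddMonoidAlgebra ℤ G) * ofFinset (univ.filter (· ∈ K)) := by
  ext g
  rw [coeff_ofFinset_mul_inv, coeff_add, Finsupp.add_apply, coeff_intCast_mul,
    coeff_intCast_mul, coeff_ofFinset, coeff_one_eq]
  by_cases h0 : g = 0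
  · subst h0
    rw [card_filter_sub_eq_zero]
    simp [K.zero_mem]
  by_cases hg : g ∈ K
  · simp [hS g hg h0, h0, hg]
  · have : (S ×ˢ S).filter (fun p => p.1 - p.2 = g) = ∅ := by
      refine filter_eq_empty_iff.2 fun p hp h => hg ?_
      rw [mem_product] at hp
      exact h ▸ K.sub_mem (hSK _ hp.1) (hSK _ hp.2)
    simp [this, h0, hg]

lemma coeff_mul_ofFinset (f : AddMonoidAlgebra ℤ G) (S : Finset G) (g : G) :
    (f * ofFinset S).coeff g = ∑ x ∈ S, f.coeff (g - x) := by
  simp [ofFinset, Finset.mul_sum, coeff_sum, sub_eq_add_neg]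

lemma ofFinset_mul_subgroup [Fintype G] (K : AddSubgroup G) (S : Finset G)
    (hSK : ∀ x ∈ S, x ∈ K) :
    ofFinset S * ofFinset (univ.filter (· ∈ K))
      = ((S.card : ℤ) : AddMonoidAlgebra ℤ G) * ofFinset (univ.filter (· ∈ K)) := by
  ext g
  rw [mul_comm, coeff_mul_ofFinset, coeff_intCast_mul]
  have : ∀ x ∈ S, (ofFinset (univ.filter (· ∈ K))).coeff (g - x)
      = (ofFinset (univ.filter (· ∈ K))).coeff g := fun x hx => by
    simp [coeff_ofFinset, sub_eq_add_neg, K.add_mem_cancel_right (K.neg_mem (hSK x hx))]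
  rw [Finset.sum_congr rfl this]
  simp

end GroupRing

open GroupRing

/-- If `D` is an `H`-fine difference set with associated natural number `s`
which is composite, i.e. `D = A + B` uniquely with `|A| = s` and `B` a difference set for `H`,
then `|B|·s = k`, `A` is disjoint from `H`, no nonzero element of `H` is a difference of two
elements of `A`, every `g ∉ H` is a difference of elements of `A` exactly `(s−1)/h` times
(so `A` is an `RDS(s+1, h, s, (s−1)/h)` disjoint from `H`), and `v − k` divides `k − 1`. -/
theorem stmt_9 {G : Type*} [AddCommGroup G] [Fintype G]
    (D : Finset G) (Λ : ℕ)
    (hk0 : 0 < D.card) (hkv : D.card < Fintype.card G)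
    (hD : ∀ g : G, g ≠ 0 → ((D ×ˢ D).filter (fun p => p.1 - p.2 = g)).card = Λ)
    (H : AddSubgroup G) (s : ℕ)
    (hdisj : ∀ x ∈ D, x ∉ H)
    (hfine : Nat.card H * (s + 1) = Fintype.card G)
    (hS : s ^ 2 * (Fintype.card G - D.card) = D.card * (Fintype.card G - 1))
    (A B : Finset G) (hA : A.card = s) (hBH : ∀ b ∈ B, b ∈ H)
    (hBds : ∃ μ : ℕ, ∀ x : G, x ∈ H → x ≠ 0 →
      ((B ×ˢ B).filter (fun p => p.1 - p.2 = x)).card = μ)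
    (hfact : ∀ g : G,
      ((A ×ˢ B).filter (fun p => p.1 + p.2 = g)).card = if g ∈ D then 1 else 0) :
    B.card * s = D.card ∧
    (∀ a ∈ A, a ∉ H) ∧
    (∀ x : G, x ∈ H → x ≠ 0 → ∀ a ∈ A, ∀ a' ∈ A, a - a' ≠ x) ∧
    (∀ g : G, g ∉ H →
      ((A ×ˢ A).filter (fun p => p.1 - p.2 = g)).card * Nat.card H = s - 1) ∧
    (Fintype.card G - D.card) ∣ (D.card - 1) := by
  have hv1 : (1 : ℤ) < Fintype.card G := by exact_mod_cast (by omega : 1 < Fintype.card G)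
  set K : Finset G := Finset.univ.filter (· ∈ H) with hK
  have hKmem : ∀ x, x ∈ K ↔ x ∈ H := fun x => by simp [hK]
  have hKcard : K.card = Nat.card H := by
    rw [Nat.card_eq_fintype_card, hK, Fintype.card_subtype]
  have hfacR : ofFinset A * ofFinset B = ofFinset D := by
    ext g
    rw [coeff_ofFinset_mul, hfact, coeff_ofFinset]
    push_cast
    rfl
  have hkN : B.card * s = D.card := by
    have := congrArg aug hfacR
    rw [map_mul, aug_ofFinset, aug_ofFinset, aug_ofFinset, hA] at this
    rw [mul_comm]
    exact_mod_cast this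
  have hs : 0 < s := Nat.pos_of_ne_zero fun h => by simp [h] at hkN; omega
  have hβ : 0 < B.card := Nat.pos_of_ne_zero fun h => by simp [h] at hkN; omega
  have hh : 0 < Nat.card H := Nat.card_pos
  have hDR := ofFinset_mul_inv_self ⊤ D Λ (by simp) (fun x _ hx => hD x hx)
  simp only [AddSubgroup.mem_top, Finset.filter_true] at hDR
  have hAR : (∀ a ∈ A, a ∉ H) := by
    intro a ha haH
    obtain ⟨b, hb⟩ := Finset.card_pos.1 hβ
    have h1 : (a, b) ∈ (A ×ˢ B).filter (fun p => p.1 + p.2 = a + b) := by simp [ha, hb]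
    have h2 := hfact (a + b)
    by_cases hab : a + b ∈ D
    · exact hdisj _ hab (H.add_mem haH (hBH b hb))
    · rw [if_neg hab, Finset.card_eq_zero] at h2
      simp [h2] at h1
  obtain ⟨μ, hμ, hμ1⟩ : ∃ μ : ℕ, (∀ x : G, x ∈ H → x ≠ 0 →
      ((B ×ˢ B).filter (fun p => p.1 - p.2 = x)).card = μ) ∧
      ((∀ x ∈ H, x = 0) → μ = 0) := by
    by_cases hH : ∀ x ∈ H, x = 0
    · exact ⟨0, fun x hx hx0 => absurd (hH x hx) hx0, fun _ => rfl⟩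
    · obtain ⟨μ, hμ⟩ := hBds
      exact ⟨μ, hμ, fun h => absurd h hH⟩
  have hBR := ofFinset_mul_inv_self H B μ hBH hμ
  have hKK := ofFinset_mul_subgroup H K (fun x hx => (hKmem x).1 hx)
  have hUK : ofFinset (Finset.univ : Finset G) * ofFinset K
      = ((K.card : ℤ) : AddMonoidAlgebra ℤ G) * ofFinset Finset.univ := by
    have := ofFinset_mul_subgroup (⊤ : AddSubgroup G) K (by simp)
    simp only [AddSubgroup.mem_top, Finset.filter_true] at this
    rw [mul_comm, this]
  rw [← hK] at hBR hKK
  have augD := congrArg aug hDR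
  have augB := congrArg aug hBR
  simp only [map_mul, map_add, map_intCast, aug_ofFinset, aug_inv_ofFinset,
    Finset.card_univ, mul_one, Int.cast_id] at augD augB
  have hXY : ofFinset A * inv (ofFinset A) * (ofFinset B * inv (ofFinset B))
      = ofFinset D * inv (ofFinset D) := by
    rw [← hfacR, map_mul]
    ring
  set X := ofFinset A * inv (ofFinset A) with hX
  have hXc : ∀ g, X.coeff g = ((A ×ˢ A).filter (fun p => p.1 - p.2 = g)).card :=
    coeff_ofFinset_mul_inv A A
  have hX0 : X.coeff 0 = s := by rw [hXc, card_filter_sub_eq_zero, hA]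
  -- numerical relations
  have hkZ : (B.card : ℤ) * s = D.card := by exact_mod_cast hkN
  have hvZ : (Nat.card H : ℤ) * (s + 1) = Fintype.card G := by exact_mod_cast hfine
  have hSZ : (s : ℤ) ^ 2 * (Fintype.card G - D.card) = D.card * (Fintype.card G - 1) := by
    have := congrArg (Nat.cast : ℕ → ℤ) hS
    push_cast [Nat.cast_sub hkv.le, Nat.cast_sub (by omega : 1 ≤ Fintype.card G)] at this
    exact this
  have hsZ : (0 : ℤ) < s := by exact_mod_cast hs
  have hβZ : (0 : ℤ) < B.card := by exact_mod_cast hβ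
  have hhZ : (0 : ℤ) < Nat.card H := by exact_mod_cast hh
  rw [hKcard] at augB hKK hUK
  generalize hv : (Fintype.card G : ℤ) = v at *
  generalize hk : (D.card : ℤ) = k at *
  generalize hβ' : (B.card : ℤ) = β at *
  generalize hs' : (s : ℤ) = t at *
  generalize hh' : (Nat.card H : ℤ) = h at *
  generalize hΛ' : (Λ : ℤ) = l at *
  generalize hμ' : (μ : ℤ) = u at *
  have hS1 : t * (v - k) = β * (v - 1) := by
    apply mul_left_cancel₀ hsZ.ne'
    linear_combination hSZ - (v - 1) * hkZ
  have hn : k - l = β ^ 2 := by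
    apply mul_right_cancel₀ (sub_pos.2 hv1).ne'
    linear_combination augD + (k - v) * hkZ + β * hS1
  have hlh : l * h = (t - 1) * β ^ 2 := by
    apply mul_right_cancel₀ (by positivity : t + 1 ≠ 0)
    linear_combination l * hvZ - augD - (k + β * t) * hkZ - hn
  have hn0 : (β ^ 2 : ℤ) ≠ 0 := by positivity
  rw [hDR, hBR, hn] at hXY
  have hXK : ((β ^ 2 : ℤ) : AddMonoidAlgebra ℤ G) * (X * ofFinset K)
      = ((β ^ 2 : ℤ) : AddMonoidAlgebra ℤ G) * ofFinset K
        + ((l * h : ℤ) : AddMonoidAlgebra ℤ G) * ofFinset Finset.univ := by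
    have hb : β ^ 2 = (β - u) + u * h := by linear_combination augB
    have hb' := congrArg (Int.cast : ℤ → AddMonoidAlgebra ℤ G) hb
    push_cast at hXY hb' ⊢
    linear_combination ofFinset K * hXY + (X * ofFinset K) * hb' - X * u * hKK
      + (l : AddMonoidAlgebra ℤ G) * hUK
  have hXeq : ((β ^ 2 * (β - u) : ℤ) : AddMonoidAlgebra ℤ G) * X
      = ((β ^ 4 : ℤ) : AddMonoidAlgebra ℤ G) * 1
        + ((β ^ 2 * l - u * (l * h) : ℤ) : AddMonoidAlgebra ℤ G) * ofFinset Finset.univ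
        - ((u * β ^ 2 : ℤ) : AddMonoidAlgebra ℤ G) * ofFinset K := by
    push_cast at hXY hXK ⊢
    linear_combination (β : AddMonoidAlgebra ℤ G) ^ 2 * hXY - (u : AddMonoidAlgebra ℤ G) * hXK
  have hcoef : ∀ g, β ^ 2 * (β - u) * X.coeff g = β ^ 4 * (if g = 0 then 1 else 0)
      + (β ^ 2 * l - u * (l * h)) - u * β ^ 2 * (if g ∈ H then 1 else 0) := by
    intro g
    have := congrArg (fun f => f.coeff g) hXeq
    simp only [AddMonoidAlgebra.coeff_add, AddMonoidAlgebra.coeff_sub, Finsupp.add_apply,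
      Finsupp.sub_apply, coeff_intCast_mul, coeff_ofFinset, coeff_one_eq, hKmem,
      Finset.mem_univ, if_true] at this
    simpa only [mul_one] using this
  have hsum : ∑ x ∈ K, X.coeff (0 - x) = t := by
    have : (_ : AddMonoidAlgebra ℤ G).coeff 0 = (_ : AddMonoidAlgebra ℤ G).coeff 0 :=
      congrArg (fun f => f.coeff 0) hXK
    rw [AddMonoidAlgebra.coeff_add, Finsupp.add_apply, coeff_intCast_mul, coeff_intCast_mul,
      coeff_intCast_mul, coeff_mul_ofFinset, coeff_ofFinset, coeff_ofFinset,
      if_pos ((hKmem 0).2 H.zero_mem), if_pos (Finset.mem_univ 0)] at this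
    apply mul_left_cancel₀ hn0
    rw [this]
    linear_combination hlh
  have hnn : ∀ g, 0 ≤ X.coeff g := fun g => by rw [hXc]; positivity
  have hzero : ∀ x ∈ H, x ≠ 0 → X.coeff x = 0 := by
    intro x hx hx0
    have h0K : (0 : G) ∈ K := (hKmem 0).2 H.zero_mem
    rw [← Finset.add_sum_erase _ _ h0K, sub_zero, hX0] at hsum
    have h1 : ∑ x ∈ K.erase 0, X.coeff (0 - x) = 0 := by linarith
    rw [Finset.sum_eq_zero_iff_of_nonneg fun _ _ => hnn _] at h1
    have := h1 (-x) (by simp [hKmem, hx, hx0])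
    simpa using this
  have hms : (∃ x ∈ H, x ≠ 0) → (β - u) * t = β ^ 2 := by
    rintro ⟨x, hx, hx0⟩
    have e1 := hcoef x
    have e2 := hcoef 0
    rw [hzero x hx hx0] at e1
    rw [hX0] at e2
    simp only [hx, hx0, H.zero_mem, if_true, if_false] at e1 e2
    apply mul_left_cancel₀ hn0
    linear_combination e2 - e1
  have htriv : (∀ x ∈ H, x = 0) → β = 1 ∧ h = 1 := by
    intro hH
    constructor
    · have : B.card ≤ 1 := Finset.card_le_one.2 fun a ha b hb => by
        rw [hH a (hBH a ha), hH b (hBH b hb)]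
      omega
    · have : H = ⊥ := (AddSubgroup.eq_bot_iff_forall H).2 hH
      rw [← hh', this]
      simp
  have hm0 : β - u ≠ 0 := by
    by_cases hH : ∀ x ∈ H, x = 0
    · have := hμ1 hH
      have := (htriv hH).1
      omega
    · push Not at hH
      intro h0
      have := hms hH
      rw [h0, zero_mul] at this
      exact hn0 this.symm
  have hout : ∀ g, g ∉ H → X.coeff g * h = t - 1 := by
    intro g hg
    have e := hcoef g
    have hg0 : g ≠ 0 := fun h => hg (h ▸ H.zero_mem)
    simp only [hg, hg0, if_false] at e
    apply mul_left_cancel₀ (mul_ne_zero hn0 hm0)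
    linear_combination h * e + (β - u) * hlh + l * h * augB
  refine ⟨hkN, hAR, ?_, ?_, ?_⟩
  · intro x hx hx0 a ha a' ha' hax
    have := hzero x hx hx0
    rw [hXc, Nat.cast_eq_zero, Finset.card_eq_zero, Finset.filter_eq_empty_iff] at this
    exact this (x := (a, a')) (by simp [ha, ha']) hax
  · intro g hg
    have := hout g hg
    rw [hXc, ← hh', ← hs'] at this
    zify [hs]
    exact this
  · by_cases hH : ∀ x ∈ H, x = 0
    · obtain ⟨h1, h2⟩ := htriv hH
      have : v - k = 1 := by rw [← hkZ, ← hvZ, h1, h2]; ring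
      have : Fintype.card G - D.card = 1 := by omega
      rw [this]
      exact one_dvd _
    · push Not at hH
      obtain ⟨d, hd⟩ := Finset.card_pos.1 hk0
      have e := hout d (hdisj d hd)
      have hm := hms hH
      have h1 : (β - (β - u)) * (v - k) = (β - u) * (k - 1) := by
        apply mul_left_cancel₀ hsZ.ne'
        apply mul_left_cancel₀ hβZ.ne'
        linear_combination β ^ 2 * hS1 - β * (v - 1) * hm
      have h2 : k - 1 = (v - k) * X.coeff d := by
        apply mul_left_cancel₀ (mul_ne_zero hm0 hhZ.ne')
        linear_combination (-h) * h1 - (v - k) * (augB + hm) - (β - u) * (v - k) * e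
      have h3 : (v - k) ∣ (k - 1) := ⟨_, h2⟩
      zify [hkv.le, hk0]
      rw [hv, hk]
      exact h3
end

section
/- Let K be a finite field and F a subfield of K with |K| = |F|² and |F| = q, and let Tr denote the field trace from K to F. Then there exists a nonzero c ∈ K such that the set E = {x ∈ K : x ≠ 0 and Tr(c·x) = 1} satisfies: |E| = q; E ∩ F = ∅; for every nonzero g ∈ K with g ∉ F there is exactly one ordered pair (d, d') ∈ E × E with d = g·d'; and for every g ∈ F with g ≠ 0 and g ≠ 1 there is no such pair. (That is, a multiplicative translate of the affine hyperplane {x : Tr(x) = 1} is a simplicial Fˣ-relative difference set in the multiplicative group Kˣ, with parameters RDS(q+1, q−1, q, 1).) -/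
open scoped Classical

/-- A nonzero linear functional on a quadratic extension that kills `1` has kernel exactly the
base field. -/
theorem LinearMap.eq_zero_iff_mem_range_algebraMap {F K : Type*} [Field F] [Field K] [Algebra F K]
    (hrank : Module.finrank F K = 2) {φ : K →ₗ[F] F} (hφ : Function.Surjective φ) (h1 : φ 1 = 0)
    (x : K) : φ x = 0 ↔ x ∈ Set.range (algebraMap F K) := by
  have : FiniteDimensional F K := Module.finite_of_finrank_pos (by omega)
  constructor
  · intro hx
    have hker : Module.finrank F (LinearMap.ker φ) = 1 := by
      have h := LinearMap.finrank_range_add_finrank_ker φ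
      rw [LinearMap.range_eq_top.2 hφ, finrank_top, Module.finrank_self, hrank] at h
      omega
    obtain ⟨a, ha⟩ := (finrank_eq_one_iff_of_nonzero' (⟨1, h1⟩ : LinearMap.ker φ)
      (by simp [Subtype.ext_iff])).1 hker ⟨x, hx⟩
    refine ⟨a, ?_⟩
    simpa [Algebra.smul_def] using congrArg Subtype.val ha
  · rintro ⟨a, rfl⟩
    rw [Algebra.algebraMap_eq_smul_one, map_smul, h1, smul_zero]

/-- In a finite quadratic extension, the trace vanishes at some nonzero element. -/
theorem Algebra.exists_ne_zero_trace_eq_zero {F K : Type*} [Field F] [Field K] [Algebra F K]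
    (hrank : Module.finrank F K = 2) : ∃ c : K, c ≠ 0 ∧ Algebra.trace F K c = 0 := by
  have : FiniteDimensional F K := Module.finite_of_finrank_pos (by omega)
  have hker : LinearMap.ker (Algebra.trace F K) ≠ ⊥ :=
    LinearMap.ker_ne_bot_of_finrank_lt (by rw [hrank, Module.finrank_self]; norm_num)
  obtain ⟨c, hc, hc0⟩ := Submodule.exists_mem_ne_zero_of_ne_bot hker
  exact ⟨c, hc0, hc⟩

/-- Let `K` be a finite field and `F` a subfield with `|K| = |F|² = q²`.
Then some nonzero multiplicative translate `E = {x ≠ 0 : Tr_{K/F}(c·x) = 1}` of the affine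
hyperplane `{x : Tr(x) = 1}` has `|E| = q`, is disjoint from `F`, every `g ∉ F ∪ {0}` is a
ratio of elements of `E` exactly once, and no `g ∈ F \ {0, 1}` is such a ratio: `E` is a
simplicial `Fˣ`-relative difference set in `Kˣ`, with parameters `RDS(q+1, q−1, q, 1)`. -/
theorem stmt_15 (F K : Type*) [Field F] [Field K] [Fintype F] [Fintype K] [Algebra F K]
    (hcard : Fintype.card K = Fintype.card F ^ 2) :
    ∃ c : K, c ≠ 0 ∧
      Nat.card {x : K // x ≠ 0 ∧ Algebra.trace F K (c * x) = 1} = Fintype.card F ∧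
      (∀ x : K, x ≠ 0 → Algebra.trace F K (c * x) = 1 → x ∉ Set.range (algebraMap F K)) ∧
      (∀ g : K, g ≠ 0 → g ∉ Set.range (algebraMap F K) →
        Nat.card {p : K × K //
          (p.1 ≠ 0 ∧ Algebra.trace F K (c * p.1) = 1) ∧
          (p.2 ≠ 0 ∧ Algebra.trace F K (c * p.2) = 1) ∧ p.1 = g * p.2} = 1) ∧
      (∀ g : K, g ∈ Set.range (algebraMap F K) → g ≠ 0 → g ≠ 1 →
        ¬ ∃ p : K × K,
          (p.1 ≠ 0 ∧ Algebra.trace F K (c * p.1) = 1) ∧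
          (p.2 ≠ 0 ∧ Algebra.trace F K (c * p.2) = 1) ∧ p.1 = g * p.2) := by
  have hrank : Module.finrank F K = 2 :=
    Nat.pow_right_injective (Fintype.one_lt_card (α := F))
      ((Module.card_eq_pow_finrank (K := F) (V := K)).symm.trans hcard)
  obtain ⟨c, hc0, hc⟩ := Algebra.exists_ne_zero_trace_eq_zero hrank
  obtain ⟨φ, hφ⟩ : ∃ φ : K →ₗ[F] F, ∀ x, Algebra.trace F K (c * x) = φ x :=
    ⟨Algebra.trace F K ∘ₗ LinearMap.mulLeft F c, fun _ => rfl⟩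
  have hsurj : Function.Surjective φ := fun a => by
    obtain ⟨y, hy⟩ := Algebra.trace_surjective F K a
    exact ⟨c⁻¹ * y, by rw [← hφ, mul_inv_cancel_left₀ hc0, hy]⟩
  have hker := LinearMap.eq_zero_iff_mem_range_algebraMap hrank hsurj
    (by rw [← hφ, mul_one, hc])
  have hne : ∀ x, φ x = 1 → x ≠ 0 := by
    rintro x hx rfl
    simp at hx
  have hmul : ∀ (a : F) (x : K), φ (algebraMap F K a * x) = a * φ x := fun a x => by
    rw [← Algebra.smul_def, map_smul, smul_eq_mul]
  obtain ⟨x₀, hx₀⟩ := hsurj 1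
  have hmem : ∀ a : F, φ (x₀ + algebraMap F K a) = 1 := fun a => by
    rw [map_add, hx₀, (hker _).2 ⟨a, rfl⟩, add_zero]
  have hex : ∀ x, φ x = 1 → ∃ a : F, x₀ + algebraMap F K a = x := fun x hx => by
    obtain ⟨a, ha⟩ := (hker (x - x₀)).1 (by rw [map_sub, hx, hx₀, sub_self])
    exact ⟨a, by rw [ha, add_sub_cancel]⟩
  refine ⟨c, hc0, ?_⟩
  simp only [hφ]
  refine ⟨?_, ?_, ?_, ?_⟩
  · rw [← Nat.card_eq_fintype_card]
    refine (Nat.card_congr (Equiv.ofBijective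
      (fun a : F => (⟨x₀ + algebraMap F K a, hne _ (hmem a), hmem a⟩ :
        {x : K // x ≠ 0 ∧ φ x = 1})) ⟨fun a b hab => ?_, ?_⟩)).symm
    · exact (algebraMap F K).injective (add_left_cancel (congrArg Subtype.val hab))
    · rintro ⟨x, -, hx⟩
      obtain ⟨a, ha⟩ := hex x hx
      exact ⟨a, Subtype.ext ha⟩
  · intro x _ hx hxF
    rw [(hker x).2 hxF] at hx
    exact zero_ne_one hx
  · intro g _ hg
    have hg' : φ g ≠ 0 := fun h => hg ((hker g).1 h)
    have hval : ∀ a : F, φ (g * (x₀ + algebraMap F K a)) = φ (g * x₀) + a * φ g := fun a => by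
      rw [mul_add, map_add, mul_comm g (algebraMap F K a), hmul]
    rw [Nat.card_eq_one_iff_unique]
    refine ⟨⟨?_⟩, ?_⟩
    · rintro ⟨⟨w, y⟩, ⟨_, h1⟩, ⟨_, hy⟩, hw⟩ ⟨⟨v, z⟩, ⟨_, h2⟩, ⟨_, hz⟩, hv⟩
      dsimp only at h1 hy hw h2 hz hv
      subst hw hv
      obtain ⟨a, rfl⟩ := hex y hy
      obtain ⟨b, rfl⟩ := hex z hz
      have hab : a = b := mul_right_cancel₀ hg'
        (add_left_cancel ((hval a).symm.trans (h1.trans (h2.symm.trans (hval b)))))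
      subst hab
      rfl
    · have h := hval ((1 - φ (g * x₀)) / φ g)
      rw [div_mul_cancel₀ _ hg', add_sub_cancel] at h
      exact ⟨⟨(_, _), ⟨hne _ h, h⟩, ⟨hne _ (hmem _), hmem _⟩, rfl⟩⟩
  · rintro _ ⟨a, rfl⟩ _ ha ⟨⟨w, y⟩, ⟨-, h1⟩, ⟨-, hy⟩, hw⟩
    dsimp only at h1 hy hw
    rw [hw, hmul, hy, mul_one] at h1
    exact ha (by rw [h1, map_one])
end

section
/- Let F and F' be finite fields of odd orders q and q + 2 respectively. Let 𝒮(F) = {x ∈ F : x ≠ 0 and x is a square}, 𝒩(F) = {x ∈ F : x ≠ 0 and x is not a square}, and similarly for F'. Let D ⊆ F × F' be D = ({0} × (F' ∖ {0})) ∪ (𝒮(F) × 𝒩(F')) ∪ (𝒩(F) × 𝒮(F')) (the complement of the twin prime power difference set). Then D ∩ (F × {0}) = ∅, and for every x ∈ F and nonzero y ∈ F': if y ∈ 𝒮(F') then {h ∈ F : (x + h, y) ∈ D} = (F ∖ 𝒮(F)) − x, while if y ∈ 𝒩(F') then {h ∈ F : (x + h, y) ∈ D} = (F ∖ 𝒩(F))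 − x; in either case this set has cardinality (q + 1)/2. -/
open scoped Classical

/-- The complement of the twin prime power difference set in `F × F'`:
`D = ({0} × F'ˣ) ∪ (𝒮(F) × 𝒩(F')) ∪ (𝒩(F) × 𝒮(F'))`. -/
def tppD (F F' : Type*) [Field F] [Field F'] : Set (F × F') :=
  {p | (p.1 = 0 ∧ p.2 ≠ 0) ∨
       (p.1 ≠ 0 ∧ IsSquare p.1 ∧ p.2 ≠ 0 ∧ ¬ IsSquare p.2) ∨
       (p.1 ≠ 0 ∧ ¬ IsSquare p.1 ∧ p.2 ≠ 0 ∧ IsSquare p.2)}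

/-- In a finite field of odd order `q`, for each sign `ε`, exactly `(q + 1) / 2` elements have
quadratic character different from `ε`. -/
theorem two_mul_card_quadraticChar_ne {F : Type*} [Field F] [Fintype F] (hF : ringChar F ≠ 2)
    {ε : ℤ} (hε : ε = 1 ∨ ε = -1) :
    2 * Fintype.card {a : F // quadraticChar F a ≠ ε} = Fintype.card F + 1 := by
  have indicator_eq (a : F) : 2 * (if quadraticChar F a ≠ ε then 1 else 0 : ℤ) =
      1 + (if a = 0 then 1 else 0) - ε * quadraticChar F a := by
    by_cases ha : a = 0
    · rcases hε with rfl | rfl <;> simp [ha]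
    · rcases hε with rfl | rfl <;> rcases quadraticChar_dichotomy ha with h | h <;> simp [ha, h]
  have hsum := Finset.sum_congr (rfl : (Finset.univ : Finset F) = Finset.univ)
    fun a _ => indicator_eq a
  rw [← Finset.mul_sum, Finset.sum_sub_distrib, Finset.sum_add_distrib, ← Finset.mul_sum,
    quadraticChar_sum_zero hF, Finset.sum_boole] at hsum
  rw [Fintype.card_subtype]
  zify
  simpa using hsum

theorem mem_tppD_iff_of_isSquare {F F' : Type*} [Field F] [Field F'] {a : F} {y : F'}
    (hy : y ≠ 0) (hsq : IsSquare y) : (a, y) ∈ tppD F F' ↔ ¬ (a ≠ 0 ∧ IsSquare a) := by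
  simp only [tppD, Set.mem_ofPred_eq]
  tauto

theorem mem_tppD_iff_of_not_isSquare {F F' : Type*} [Field F] [Field F'] {a : F} {y : F'}
    (hy : y ≠ 0) (hsq : ¬ IsSquare y) : (a, y) ∈ tppD F F' ↔ ¬ (a ≠ 0 ∧ ¬ IsSquare a) := by
  simp only [tppD, Set.mem_ofPred_eq]
  tauto

theorem exists_mem_tppD_iff_quadraticChar_ne {F F' : Type*} [Field F] [Fintype F] [Field F']
    {y : F'} (hy : y ≠ 0) :
    ∃ ε : ℤ, (ε = 1 ∨ ε = -1) ∧ ∀ a : F, (a, y) ∈ tppD F F' ↔ quadraticChar F a ≠ ε := by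
  by_cases hsq : IsSquare y
  · refine ⟨1, Or.inl rfl, fun a => ?_⟩
    rw [mem_tppD_iff_of_isSquare hy hsq]
    by_cases ha : a = 0
    · simp [ha]
    · rw [ne_eq (quadraticChar F a), quadraticChar_one_iff_isSquare ha]
      simp [ha]
  · refine ⟨-1, Or.inr rfl, fun a => ?_⟩
    rw [mem_tppD_iff_of_not_isSquare hy hsq, ne_eq (quadraticChar F a),
      quadraticChar_neg_one_iff_not_isSquare]
    by_cases ha : a = 0
    · simp [ha]
    · simp [ha]

/-- Let `F, F'` be finite fields of odd orders `q` and `q + 2`.  The set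
`D` (complement of the twin prime power difference set) is disjoint from `H = F × {0}`, and
for every `x ∈ F` and nonzero `y ∈ F'`: if `y` is a square then
`{h : (x+h, y) ∈ D} = (F ∖ 𝒮(F)) − x`, if `y` is a nonsquare then
`{h : (x+h, y) ∈ D} = (F ∖ 𝒩(F)) − x`; either way the set has `(q+1)/2` elements. -/
theorem stmt_17 (F F' : Type*) [Field F] [Field F'] [Fintype F] [Fintype F']
    (hodd : Odd (Fintype.card F)) (hodd' : Odd (Fintype.card F'))
    (hcard : Fintype.card F' = Fintype.card F + 2) :
    (∀ x : F, (x, (0 : F')) ∉ tppD F F') ∧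
    (∀ x : F, ∀ y : F', y ≠ 0 → IsSquare y →
      ∀ h : F, ((x + h, y) ∈ tppD F F' ↔ ¬ (x + h ≠ 0 ∧ IsSquare (x + h)))) ∧
    (∀ x : F, ∀ y : F', y ≠ 0 → ¬ IsSquare y →
      ∀ h : F, ((x + h, y) ∈ tppD F F' ↔ ¬ (x + h ≠ 0 ∧ ¬ IsSquare (x + h)))) ∧
    (∀ x : F, ∀ y : F', y ≠ 0 →
      2 * Nat.card {h : F // (x + h, y) ∈ tppD F F'} = Fintype.card F + 1) := by
  refine ⟨fun x => by simp [tppD], fun x y hy hsq h => mem_tppD_iff_of_isSquare hy hsq,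
    fun x y hy hsq h => mem_tppD_iff_of_not_isSquare hy hsq, fun x y hy => ?_⟩
  have hF : ringChar F ≠ 2 := fun h => by
    have := FiniteField.even_card_of_char_two h
    have := Nat.odd_iff.mp hodd
    omega
  obtain ⟨ε, hε, hmem⟩ := exists_mem_tppD_iff_quadraticChar_ne (F := F) hy
  rw [← two_mul_card_quadraticChar_ne hF hε, ← Nat.card_eq_fintype_card,
    Nat.card_congr ((Equiv.addLeft x).subtypeEquiv
      (q := fun a => quadraticChar F a ≠ ε) fun h => hmem (x + h))]
end

section
/- Let F be a finite field of odd order q, and let 𝒮 = {x ∈ F : x ≠ 0 and x is a square} and 𝒩 = {x ∈ F : x ≠ 0 and x is not a square}. Then there exists x ∈ F with 𝒩 = 𝒮 + x (i.e., 𝒩 is an additive translate of 𝒮) if and only if q = 3. -/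
/-- In a finite field the product of two nonsquares is a square. -/
theorem isSquare_mul_of_not_isSquare {F : Type*} [Field F] [Fintype F]
    {a b : F} (ha : ¬ IsSquare a) (hb : ¬ IsSquare b) :
    IsSquare (a * b) := by
  classical
  have ha0 : a ≠ 0 := by rintro rfl; exact ha IsSquare.zero
  have hb0 : b ≠ 0 := by rintro rfl; exact hb IsSquare.zero
  rw [← quadraticChar_one_iff_isSquare (mul_ne_zero ha0 hb0), map_mul,
    (quadraticChar_neg_one_iff_not_isSquare (F := F)).2 ha,
    (quadraticChar_neg_one_iff_not_isSquare (F := F)).2 hb]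
  norm_num

/-- If the nonsquares are the translate of the nonzero squares by `x`, then `1` is the only
nonzero square. -/
theorem sq_eq_one_of_nonsquares_eq_translate {F : Type*} [Field F] [Fintype F]
    {x : F}
    (h : ∀ z : F, (z ≠ 0 ∧ ¬ IsSquare z) ↔ (z - x ≠ 0 ∧ IsSquare (z - x)))
    {y : F} (hy : y ≠ 0) : y ^ 2 = 1 := by
  have hx0 : x ≠ 0 := by
    rintro rfl
    have := h 1
    simp at this
  have hxs : IsSquare x := by
    by_contra hx
    exact ((h x).1 ⟨hx0, hx⟩).1 (sub_self x)
  have hneg : ¬ IsSquare (-1 : F) := by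
    intro hm
    refine ((h 0).2 ⟨by simpa using hx0, ?_⟩).1 rfl
    simpa using hm.mul hxs
  have hmul : ∀ w : F, IsSquare (y ^ 2 * w) ↔ IsSquare w := by
    intro w
    refine ⟨fun hw => ?_, fun hw => (IsSquare.sq y).mul hw⟩
    have := (IsSquare.sq y⁻¹).mul hw
    rwa [← mul_assoc, ← mul_pow, inv_mul_cancel₀ hy, one_pow, one_mul] at this
  have hscale : ∀ z : F, (z ≠ 0 ∧ ¬ IsSquare z) ↔
      (z - y ^ 2 * x ≠ 0 ∧ IsSquare (z - y ^ 2 * x)) := by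
    intro z
    obtain ⟨w, rfl⟩ : ∃ w, z = y ^ 2 * w := ⟨z / y ^ 2, by field_simp⟩
    rw [← mul_sub, hmul, hmul, mul_ne_zero_iff, mul_ne_zero_iff]
    simpa [hy] using h w
  have hper : ∀ w : F, (w ≠ 0 ∧ IsSquare w) ↔
      (w + (x - y ^ 2 * x) ≠ 0 ∧ IsSquare (w + (x - y ^ 2 * x))) := by
    intro w
    have := (h (w + x)).symm.trans (hscale (w + x))
    rwa [add_sub_cancel_right, add_sub_assoc] at this
  by_contra hne
  have hd : x - y ^ 2 * x ≠ 0 := by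
    intro hd
    apply hne
    apply mul_right_cancel₀ hx0
    linear_combination -hd
  have hd1 : ¬ IsSquare (x - y ^ 2 * x) := by
    intro hs
    have := (hper 0).2 (by simpa using ⟨hd, hs⟩)
    exact this.1 rfl
  refine ((hper (-(x - y ^ 2 * x))).1 ⟨neg_ne_zero.2 hd, ?_⟩).1 (neg_add_cancel _)
  simpa using isSquare_mul_of_not_isSquare hneg hd1

/-- Let `F` be a finite field of odd order `q`, with nonzero squares `𝒮`
and nonzero nonsquares `𝒩`.  Then `𝒩` is an additive translate of `𝒮` iff `q = 3`. -/
theorem stmt_18 (F : Type*) [Field F] [Fintype F] (hodd : Odd (Fintype.card F)) :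
    (∃ x : F, {z : F | z ≠ 0 ∧ ¬ IsSquare z} =
        (fun z => z + x) '' {z : F | z ≠ 0 ∧ IsSquare z}) ↔
      Fintype.card F = 3 := by
  classical
  have hF : ringChar F ≠ 2 := by
    intro h2
    have := FiniteField.even_card_of_char_two h2
    rw [Nat.odd_iff] at hodd
    omega
  have hm1 : (-1 : F) ≠ 1 := Ring.neg_one_ne_one_of_char_ne_two hF
  constructor
  · rintro ⟨x, hx⟩
    have h : ∀ z : F, (z ≠ 0 ∧ ¬ IsSquare z) ↔ (z - x ≠ 0 ∧ IsSquare (z - x)) := by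
      intro z
      simpa [← sub_eq_add_neg] using Set.ext_iff.1 hx z
    have huniv : (Finset.univ : Finset F) = {0, 1, -1} := by
      ext y
      by_cases hy : y = 0
      · simp [hy]
      · simpa [hy] using sq_eq_one_iff.1 (sq_eq_one_of_nonsquares_eq_translate h hy)
    rw [← Finset.card_univ, huniv, Finset.card_eq_three]
    exact ⟨0, 1, -1, zero_ne_one, (neg_ne_zero.2 one_ne_zero).symm, hm1.symm, rfl⟩
  · intro hq
    have hsq : ∀ y : F, y ≠ 0 → y ^ 2 = 1 := by
      intro y hy
      simpa [hq] using FiniteField.pow_card_sub_one_eq_one y hy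
    have hsquare : ∀ z : F, (z ≠ 0 ∧ IsSquare z) ↔ z = 1 := by
      refine fun z => ⟨?_, by rintro rfl; simp⟩
      rintro ⟨hz, y, rfl⟩
      rw [← sq]
      exact hsq y (left_ne_zero_of_mul hz)
    have h3 : (3 : F) = 0 := by
      have := Nat.cast_card_eq_zero F
      rwa [hq] at this
    have h2 : (1 : F) + 1 = -1 := by linear_combination h3
    refine ⟨1, ?_⟩
    simp only [hsquare, Set.ofPred_eq_eq_singleton, Set.image_singleton, h2]
    ext z
    simp only [Set.mem_ofPred_eq, Set.mem_singleton_iff]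
    constructor
    · rintro ⟨hz, hn⟩
      exact (sq_eq_one_iff.1 (hsq z hz)).resolve_left fun h => hn (h ▸ IsSquare.one)
    · rintro rfl
      have h0 : (-1 : F) ≠ 0 := neg_ne_zero.2 one_ne_zero
      exact ⟨h0, fun hs => hm1 ((hsquare _).1 ⟨h0, hs⟩)⟩
end

section
/- For every integer q ≥ 2 and every integer J ≥ 2, q^J − 1 does not divide q^{2J−2}·(q − 1). (Consequently, for a McFarland difference set with D = q^{J−1}(q^J−1)/(q−1) and S = (q^J−1)/(q−1), the quantity D²/S³ = q^{2J−2}(q−1)/(q^J−1) is never an integer, so no McFarland difference set is an amalgam.) -/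
/-- For all integers `q ≥ 2` and `J ≥ 2`, `q^J − 1` does not divide
`q^{2J−2}·(q − 1)`.  Consequently `D²/S³` is never an integer for a McFarland difference
set, so no McFarland difference set is an amalgam. -/
theorem stmt_19 (q J : ℕ) (hq : 2 ≤ q) (hJ : 2 ≤ J) :
    ¬ (q ^ J - 1 ∣ q ^ (2 * J - 2) * (q - 1)) := by
  intro h
  have hlt : q < q ^ J := lt_self_pow₀ (by omega) (by omega)
  have hcop : Nat.Coprime (q ^ J - 1) (q ^ J) := by
    have hsucc := Nat.coprime_self_add_right (m := q ^ J - 1) (n := 1)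
    rw [Nat.sub_add_cancel (by omega)] at hsucc
    exact hsucc.mpr (Nat.coprime_one_right _)
  have hcop' : Nat.Coprime (q ^ J - 1) q :=
    hcop.coprime_dvd_right (dvd_pow_self q (by omega))
  have hle := Nat.le_of_dvd (by omega) ((hcop'.pow_right _).dvd_of_dvd_mul_left h)
  omega
end
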